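/- Let A be a C*-algebra and (B_i)_{i∈I} a family of C*-algebras, and let B = (⊕Σ_{i∈I} B_i)_∞ be their ℓ∞-direct sum with coordinate projections p_i. A linear map u : A → B is decomposable if and only if every coordinate u_i = p_i ∘ u : A → B_i is decomposable with sup_{i∈I} ‖u_i‖_dec < ∞, and in that case ‖u‖_dec = sup_{i∈I} ‖u_i‖_dec. -/

import Mathlib

noncomputable section

def IsStarSquare {R n : Type*} [Fintype n] [NonUnitalSemiring R] [StarRing R]
    (M : Matrix n n R) : Prop :=
  ∃ N : Matrix n n R, M = N.conjTranspose * N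

/-- A (not necessarily linear) map between `*`-rings is *completely positive* if all of its
matrix amplifications send positive matrices (i.e. star-squares) to positive matrices. -/
def IsCPMap {A B : Type*} [NonUnitalSemiring A] [StarRing A] [NonUnitalSemiring B] [StarRing B]
    (u : A → B) : Prop :=
  ∀ (k : ℕ) (M : Matrix (Fin k) (Fin k) A), IsStarSquare M → IsStarSquare (M.map u)

section Dec

variable {A B : Type*} [NonUnitalNormedRing A] [StarRing A] [NormedSpace ℂ A]
  [NonUnitalNormedRing B] [StarRing B] [NormedSpace ℂ B]

/-- The set of `max ‖S₁‖ ‖S₂‖` over all completely positive `S₁, S₂` making the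
2×2 sandwich map completely positive. -/
def decSet (u : A →L[ℂ] B) : Set ℝ :=
  { r | ∃ S₁ S₂ : A →L[ℂ] B, IsCPMap ⇑S₁ ∧ IsCPMap ⇑S₂ ∧
      IsCPMap (fun x => (!![S₁ x, u x; star (u (star x)), S₂ x] : Matrix (Fin 2) (Fin 2) B)) ∧
      r = max ‖S₁‖ ‖S₂‖ }

/-- A map is decomposable when it is a linear combination of completely positive maps. -/
def IsDecomposable (u : A →L[ℂ] B) : Prop :=
  ∃ u₁ u₂ u₃ u₄ : A →L[ℂ] B, IsCPMap ⇑u₁ ∧ IsCPMap ⇑u₂ ∧ IsCPMap ⇑u₃ ∧ IsCPMap ⇑u₄ ∧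
    u = u₁ - u₂ + Complex.I • (u₃ - u₄)

/-- Haagerup's decomposable norm. -/
def decNorm (u : A →L[ℂ] B) : ℝ := sInf (decSet u)

end Dec

open scoped ENNReal

section Aux

theorem aux_isStarSquare_iff {R n : Type*} [Fintype n] [NonUnitalSemiring R] [StarRing R]
    (M : Matrix n n R) : IsStarSquare M ↔
      ∃ N : Matrix n n R, ∀ i j, M i j = ∑ k, star (N k i) * N k j := by
  constructor
  · rintro ⟨N, rfl⟩
    exact ⟨N, fun i j => by simp [Matrix.mul_apply]⟩
  · rintro ⟨N, h⟩
    refine ⟨N, ?_⟩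
    ext i j
    simp [Matrix.mul_apply, h]

theorem aux_cstar_add {C : Type*} [NonUnitalCStarAlgebra C] (P Q : C) :
    ∃ S : C, star P * P + star Q * Q = star S * S := by
  let _ := CStarAlgebra.spectralOrder C
  have _ := CStarAlgebra.spectralOrderedRing C
  exact CStarAlgebra.nonneg_iff_eq_star_mul_self.mp
    (add_nonneg (star_mul_self_nonneg _) (star_mul_self_nonneg _))

theorem aux_starSquare_add {R n : Type*} [Fintype n] [NonUnitalCStarAlgebra R]
    {M N : Matrix n n R} (hM : IsStarSquare M) (hN : IsStarSquare N) : IsStarSquare (M + N) := by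
  let _ := CStarAlgebra.spectralOrder R
  have _ := CStarAlgebra.spectralOrderedRing R
  obtain ⟨P, rfl⟩ := hM
  obtain ⟨Q, rfl⟩ := hN
  let P' : CStarMatrix n n R := CStarMatrix.ofMatrix P
  let Q' : CStarMatrix n n R := CStarMatrix.ofMatrix Q
  obtain ⟨S, hS⟩ := aux_cstar_add P' Q'
  exact ⟨CStarMatrix.ofMatrix.symm S, hS⟩

theorem aux_starSquare_zero {R n : Type*} [Fintype n] [NonUnitalSemiring R] [StarRing R] :
    IsStarSquare (0 : Matrix n n R) := ⟨0, by simp⟩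

theorem aux_starSquare_sum {R n ι : Type*} [Fintype n] [NonUnitalCStarAlgebra R] (s : Finset ι)
    (M : ι → Matrix n n R) (hM : ∀ i ∈ s, IsStarSquare (M i)) : IsStarSquare (∑ i ∈ s, M i) :=
  Finset.sum_induction M IsStarSquare (fun _ _ => aux_starSquare_add) aux_starSquare_zero hM

theorem aux_gram {R m n : Type*} [Fintype m] [Fintype n] [NonUnitalCStarAlgebra R]
    (M : Matrix n n R) (N : m → n → R) (h : ∀ i j, M i j = ∑ k, star (N k i) * N k j) :
    IsStarSquare M := by
  classical
  have : M = ∑ k, Matrix.of fun i j => star (N k i) * N k j := by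
    ext i j
    simp [h, Matrix.sum_apply]
  rw [this]
  refine aux_starSquare_sum _ _ fun k _ => ?_
  cases isEmpty_or_nonempty n with
  | inl _ => exact ⟨0, Subsingleton.elim _ _⟩
  | inr hn =>
    obtain ⟨i0⟩ := hn
    rw [aux_isStarSquare_iff]
    refine ⟨fun l j => if l = i0 then N k j else 0, fun i j => ?_⟩
    rw [Finset.sum_eq_single i0] <;> simp +contextual

theorem aux_entry_bound {R n : Type*} [Fintype n] [NonUnitalCStarAlgebra R]
    (M N : Matrix n n R) (h : ∀ i j, M i j = ∑ k, star (N k i) * N k j) (k j : n) :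
    ‖N k j‖ ^ 2 ≤ ‖M j j‖ := by
  let _ := CStarAlgebra.spectralOrder R
  have _ := CStarAlgebra.spectralOrderedRing R
  rw [sq, ← CStarRing.norm_star_mul_self]
  apply CStarAlgebra.norm_le_norm_of_nonneg_of_le (star_mul_self_nonneg _)
  rw [h]
  exact Finset.single_le_sum (f := fun k => star (N k j) * N k j)
    (fun i _ => star_mul_self_nonneg _) (Finset.mem_univ k)

theorem aux_comp {R n m : Type*} [Fintype n] [Fintype m] [NonUnitalSemiring R] [StarRing R]
    (M : Matrix n n (Matrix m m R)) :
    IsStarSquare M ↔ IsStarSquare (Matrix.comp n n m m R M) := by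
  rw [aux_isStarSquare_iff, aux_isStarSquare_iff]
  constructor
  · rintro ⟨N, h⟩
    refine ⟨Matrix.comp n n m m R N, fun i j => ?_⟩
    simp [Matrix.comp_apply, h, Matrix.sum_apply, Matrix.mul_apply, Fintype.sum_prod_type,
      Matrix.star_apply]
  · rintro ⟨N, h⟩
    refine ⟨(Matrix.comp n n m m R).symm N, fun i j => ?_⟩
    ext a b
    have := h (i, a) (j, b)
    simpa [Matrix.comp_apply, Matrix.sum_apply, Matrix.mul_apply, Fintype.sum_prod_type,
      Matrix.star_apply] using this

theorem aux_ev {I n : Type*} [Fintype n] {B : I → Type*} [∀ i, NonUnitalCStarAlgebra (B i)]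
    (f g : n → lp B ∞) (i : I) : ((∑ k, star (f k) * g k : lp B ∞) : ∀ i, B i) i =
      ∑ k, star ((f k : ∀ i, B i) i) * (g k : ∀ i, B i) i := by
  let e : lp B ∞ →+ B i :=
    { toFun := fun x => (x : ∀ i, B i) i
      map_zero' := rfl
      map_add' := fun _ _ => rfl }
  exact map_sum e (fun k => star (f k) * g k) Finset.univ

theorem aux_lp {I n : Type*} [Fintype n] {B : I → Type*} [∀ i, NonUnitalCStarAlgebra (B i)]
    (M : Matrix n n (lp B ∞)) :
    IsStarSquare M ↔ ∀ i, IsStarSquare (Matrix.of fun a b => (M a b : ∀ i, B i) i) := by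
  simp only [aux_isStarSquare_iff]
  constructor
  · rintro ⟨N, h⟩ i
    refine ⟨Matrix.of fun a b => (N a b : ∀ i, B i) i, fun a b => ?_⟩
    simp only [Matrix.of_apply, h]
    exact aux_ev _ _ i
  · intro h
    choose N hN using h
    have hb : ∀ a b, Memℓp (fun i => N i a b) ∞ := by
      intro a b
      refine memℓp_infty ⟨√ ‖M b b‖, ?_⟩
      rintro _ ⟨i, rfl⟩
      refine Real.le_sqrt_of_sq_le ((aux_entry_bound _ _ (hN i) a b).trans ?_)
      exact lp.norm_apply_le_norm ENNReal.top_ne_zero (M b b) i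
    refine ⟨Matrix.of fun a b => ⟨_, hb a b⟩, fun a b => ?_⟩
    apply lp.ext
    funext i
    exact (hN i a b).trans (aux_ev (fun k => (⟨_, hb k a⟩ : lp B ∞))
      (fun k => (⟨_, hb k b⟩ : lp B ∞)) i).symm

theorem aux_cp_lp {A I : Type*} [NonUnitalCStarAlgebra A] {B : I → Type*}
    [∀ i, NonUnitalCStarAlgebra (B i)] (u : A → lp B ∞) :
    IsCPMap u ↔ ∀ i, IsCPMap (fun x => (u x : ∀ i, B i) i) := by
  constructor
  · intro h i k M hM
    exact (aux_lp _).1 (h k M hM) i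
  · intro h k M hM
    exact (aux_lp _).2 fun i => h i k M hM

theorem aux_cp_lp_mat {A I : Type*} [NonUnitalCStarAlgebra A] {B : I → Type*}
    [∀ i, NonUnitalCStarAlgebra (B i)] (u : A → Matrix (Fin 2) (Fin 2) (lp B ∞)) :
    IsCPMap u ↔ ∀ i, IsCPMap
      (fun x => (Matrix.of fun a b => (u x a b : ∀ i, B i) i : Matrix (Fin 2) (Fin 2) (B i))) := by
  constructor
  · intro h i k M hM
    exact (aux_comp _).2 ((aux_lp _).1 ((aux_comp _).1 (h k M hM)) i)
  · intro h k M hM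
    exact (aux_comp _).2 ((aux_lp _).2 fun i => (aux_comp _).1 (h i k M hM))

theorem aux_decMat_lp {A I : Type*} [NonUnitalCStarAlgebra A] {B : I → Type*}
    [∀ i, NonUnitalCStarAlgebra (B i)] (u S T : A →L[ℂ] lp B ∞) (ui Si Ti : ∀ i, A →L[ℂ] B i)
    (hu : ∀ i x, ui i x = (u x : ∀ i, B i) i) (hS : ∀ i x, Si i x = (S x : ∀ i, B i) i)
    (hT : ∀ i x, Ti i x = (T x : ∀ i, B i) i) :
    IsCPMap (fun x => (!![S x, u x; star (u (star x)), T x] : Matrix (Fin 2) (Fin 2) (lp B ∞))) ↔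
    ∀ i, IsCPMap (fun x =>
      (!![Si i x, ui i x; star (ui i (star x)), Ti i x] : Matrix (Fin 2) (Fin 2) (B i))) := by
  rw [aux_cp_lp_mat]
  refine forall_congr' fun i => ?_
  have : (fun x => (!![Si i x, ui i x; star (ui i (star x)), Ti i x] :
      Matrix (Fin 2) (Fin 2) (B i))) = (fun x => (Matrix.of fun a b =>
      ((!![S x, u x; star (u (star x)), T x] : Matrix (Fin 2) (Fin 2) (lp B ∞)) a b
        : ∀ i, B i) i : Matrix (Fin 2) (Fin 2) (B i))) := by
    funext x
    ext a b
    fin_cases a <;> fin_cases b <;> simp [hu, hS, hT, lp.coeFn_star]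
  rw [this]

theorem aux_cp_star {A B : Type*} [NonUnitalCStarAlgebra A] [NonUnitalCStarAlgebra B]
    (u : A →L[ℂ] B) (h : IsCPMap u) (x : A) : star (u (star x)) = u x := by
  let _ := CStarAlgebra.spectralOrder A
  have _ := CStarAlgebra.spectralOrderedRing A
  have hx : x ∈ Submodule.span ℂ {a : A | 0 ≤ a} := by
    rw [CStarAlgebra.span_nonneg]; trivial
  induction hx using Submodule.span_induction with
  | zero => simp
  | add x y _ _ hx hy => simp [hx, hy]
  | smul c x _ hx => simp [hx]
  | mem x hx =>
    have hx' : 0 ≤ x := hx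
    obtain ⟨y, rfl⟩ := CStarAlgebra.nonneg_iff_eq_star_mul_self.mp hx'
    obtain ⟨N, hN⟩ := (aux_isStarSquare_iff _).1 (h 1 (Matrix.of fun _ _ => star y * y)
      ((aux_isStarSquare_iff _).2 ⟨Matrix.of fun _ _ => y, by simp⟩))
    have := hN 0 0
    simp at this
    simp [this]

theorem aux_decMat_of {A B : Type*} [NonUnitalCStarAlgebra A] [NonUnitalCStarAlgebra B]
    (u : A → B) (h : IsCPMap u) (c : ℂ) (hc : star c * c = 1) :
    IsCPMap (fun x => (!![u x, c • u x; star c • u x, u x] : Matrix (Fin 2) (Fin 2) B)) := by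
  intro k M hM
  rw [aux_comp]
  obtain ⟨N, hN⟩ := (aux_isStarSquare_iff _).1 (h k M hM)
  have hN' : ∀ i j, u (M i j) = ∑ k, star (N k i) * N k j := hN
  have hc' : c * star c = 1 := by rw [mul_comm]; exact hc
  refine aux_gram (m := Fin k) _ (fun l p => (![1, c] p.2 : ℂ) • N l p.1) ?_
  rintro ⟨i, a⟩ ⟨j, b⟩
  fin_cases a <;> fin_cases b <;>
    simp [Matrix.comp_apply, hN', Finset.smul_sum, smul_mul_assoc, mul_smul_comm, smul_smul]
  all_goals
    have hc2 : c * (starRingEnd ℂ) c = 1 := hc'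
    simp [hc2]

theorem aux_compress {A B : Type*} [NonUnitalCStarAlgebra A] [NonUnitalCStarAlgebra B]
    (S u v T : A → B)
    (h : IsCPMap (fun x => (!![S x, u x; v x, T x] : Matrix (Fin 2) (Fin 2) B))) (d : Fin 2 → ℂ) :
    IsCPMap (fun x => (star (d 0) * d 0) • S x + (star (d 0) * d 1) • u x
      + (star (d 1) * d 0) • v x + (star (d 1) * d 1) • T x) := by
  intro k M hM
  obtain ⟨N, hN⟩ : ∃ N : Fin k × Fin 2 → Fin k × Fin 2 → B, _ :=
    (aux_isStarSquare_iff _).1 ((aux_comp _).1 (h k M hM))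
  have h1 : ∀ i j, S (M i j) = ∑ k, star (N k (i, 0)) * N k (j, 0) := fun i j => hN (i, 0) (j, 0)
  have h2 : ∀ i j, u (M i j) = ∑ k, star (N k (i, 0)) * N k (j, 1) := fun i j => hN (i, 0) (j, 1)
  have h3 : ∀ i j, v (M i j) = ∑ k, star (N k (i, 1)) * N k (j, 0) := fun i j => hN (i, 1) (j, 0)
  have h4 : ∀ i j, T (M i j) = ∑ k, star (N k (i, 1)) * N k (j, 1) := fun i j => hN (i, 1) (j, 1)
  refine aux_gram _ (fun p i => d 0 • N p (i, 0) + d 1 • N p (i, 1)) fun i j => ?_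
  simp only [Matrix.map_apply, h1, h2, h3, h4, Finset.smul_sum, ← Finset.sum_add_distrib]
  refine Finset.sum_congr rfl fun p _ => ?_
  simp only [star_add, star_smul, add_mul, mul_add, smul_mul_assoc, mul_smul_comm, smul_smul]
  module

theorem aux_cp_add {A B : Type*} [NonUnitalCStarAlgebra A] [NonUnitalCStarAlgebra B]
    (u v : A → B) (hu : IsCPMap u) (hv : IsCPMap v) : IsCPMap (fun x => u x + v x) := by
  intro k M hM
  exact aux_starSquare_add (hu k M hM) (hv k M hM)

theorem aux_cp_add_mat {A B : Type*} [NonUnitalCStarAlgebra A] [NonUnitalCStarAlgebra B]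
    (u v : A → Matrix (Fin 2) (Fin 2) B) (hu : IsCPMap u) (hv : IsCPMap v) :
    IsCPMap (fun x => u x + v x) := by
  intro k M hM
  exact (aux_comp _).2 (aux_starSquare_add ((aux_comp _).1 (hu k M hM)) ((aux_comp _).1 (hv k M hM)))

theorem aux_dec_nonempty {A B : Type*} [NonUnitalCStarAlgebra A] [NonUnitalCStarAlgebra B]
    (u : A →L[ℂ] B) (h : IsDecomposable u) : (decSet u).Nonempty := by
  obtain ⟨u₁, u₂, u₃, u₄, h₁, h₂, h₃, h₄, rfl⟩ := h
  have hS : IsCPMap (⇑(u₁ + u₂ + u₃ + u₄)) :=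
    aux_cp_add _ _ (aux_cp_add _ _ (aux_cp_add _ _ h₁ h₂) h₃) h₄
  refine ⟨_, u₁ + u₂ + u₃ + u₄, u₁ + u₂ + u₃ + u₄, hS, hS, ?_, rfl⟩
  have := aux_cp_add_mat _ _ (aux_cp_add_mat _ _ (aux_cp_add_mat _ _
    (aux_decMat_of _ h₁ 1 (by simp)) (aux_decMat_of _ h₂ (-1) (by simp)))
    (aux_decMat_of _ h₃ Complex.I (by simp))) (aux_decMat_of _ h₄ (-Complex.I) (by simp))
  convert this using 2 with x
  ext a b
  fin_cases a <;> fin_cases b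
  · simp
  · simp [smul_sub]; abel
  · simp [smul_sub, aux_cp_star, h₁, h₂, h₃, h₄]; abel
  · simp

def auxSharp {A B : Type*} [NonUnitalCStarAlgebra A] [NonUnitalCStarAlgebra B]
    (u : A →L[ℂ] B) : A →L[ℂ] B :=
  LinearMap.mkContinuous
    { toFun := fun x => star (u (star x))
      map_add' := by simp
      map_smul' := by simp } ‖u‖ (fun x => by
        simpa using u.le_opNorm (star x))

theorem aux_dec_of_nonempty {A B : Type*} [NonUnitalCStarAlgebra A] [NonUnitalCStarAlgebra B]
    (u : A →L[ℂ] B) (h : (decSet u).Nonempty) : IsDecomposable u := by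
  obtain ⟨_, S, T, -, -, h, -⟩ := h
  let w : ℂ → A →L[ℂ] B := fun c =>
    (1/4 : ℂ) • (S + c • u + star c • auxSharp u + (star c * c) • T)
  have hw : ∀ c, IsCPMap (w c) := by
    intro c
    convert aux_compress _ _ _ _ h ![1/2, c/2] using 2 with x
    have e1 : (star (![1/2, c/2] 0 : ℂ) * (![1/2, c/2] 0 : ℂ)) = 1/4 := by simp; norm_num
    have e2 : (star (![1/2, c/2] 0 : ℂ) * (![1/2, c/2] 1 : ℂ)) = 1/4 * c := by simp; ring
    have e3 : (star (![1/2, c/2] 1 : ℂ) * (![1/2, c/2] 0 : ℂ)) = 1/4 * star c := by simp; ring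
    have e4 : (star (![1/2, c/2] 1 : ℂ) * (![1/2, c/2] 1 : ℂ)) = 1/4 * (star c * c) := by
      simp; ring
    rw [e1, e2, e3, e4]
    have hs : auxSharp u x = star (u (star x)) := rfl
    rw [← hs]
    simp only [w, ContinuousLinearMap.smul_apply, ContinuousLinearMap.add_apply]
    module
  refine ⟨w 1, w (-1), w (-Complex.I), w Complex.I, hw _, hw _, hw _, hw _, ?_⟩
  ext x
  simp [w, smul_smul, smul_sub, smul_add]
  match_scalars <;> ring_nf <;> simp <;> ring_nf

theorem aux_decNorm_nonneg {A B : Type*} [NonUnitalCStarAlgebra A] [NonUnitalCStarAlgebra B]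
    (u : A →L[ℂ] B) : 0 ≤ decNorm u := by
  apply Real.sInf_nonneg
  rintro _ ⟨S, T, -, -, -, rfl⟩
  exact le_max_of_le_left (norm_nonneg _)

theorem aux_decNorm_le {A B : Type*} [NonUnitalCStarAlgebra A] [NonUnitalCStarAlgebra B]
    (u : A →L[ℂ] B) {r : ℝ} (h : r ∈ decSet u) : decNorm u ≤ r := by
  refine csInf_le ⟨0, ?_⟩ h
  rintro _ ⟨S, T, -, -, -, rfl⟩
  exact le_max_of_le_left (norm_nonneg _)

def auxCoord {A I : Type*} [NonUnitalCStarAlgebra A] {B : I → Type*}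
    [∀ i, NonUnitalCStarAlgebra (B i)] (S : A →L[ℂ] lp B ∞) (i : I) : A →L[ℂ] B i :=
  LinearMap.mkContinuous
    { toFun := fun x => (S x : ∀ i, B i) i
      map_add' := by simp
      map_smul' := by simp } ‖S‖ (fun x =>
        (lp.norm_apply_le_norm ENNReal.top_ne_zero (S x) i).trans (S.le_opNorm x))

def auxGlue {A I : Type*} [NonUnitalCStarAlgebra A] {B : I → Type*}
    [∀ i, NonUnitalCStarAlgebra (B i)] (S : ∀ i, A →L[ℂ] B i) (C : ℝ) (hC : 0 ≤ C)
    (h : ∀ i, ‖S i‖ ≤ C) : A →L[ℂ] lp B ∞ :=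
  LinearMap.mkContinuous
    { toFun := fun x => ⟨fun i => S i x, memℓp_infty ⟨C * ‖x‖, by
        rintro _ ⟨i, rfl⟩
        exact (S i).le_of_opNorm_le (h i) x⟩⟩
      map_add' := fun x y => by
        apply lp.ext; funext i; exact map_add (S i) x y
      map_smul' := fun c x => by
        apply lp.ext; funext i; exact map_smul (S i) c x } C (fun x => by
        refine lp.norm_le_of_forall_le (by positivity) fun i => ?_
        exact (S i).le_of_opNorm_le (h i) x)

theorem aux_coord_dec {A I : Type*} [NonUnitalCStarAlgebra A] {B : I → Type*}
    [∀ i, NonUnitalCStarAlgebra (B i)]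
    (u : A →L[ℂ] lp B ∞) (ui : ∀ i, A →L[ℂ] B i)
    (hui : ∀ i x, ui i x = (u x : ∀ i, B i) i) {r : ℝ} (hr : r ∈ decSet u) (i : I) :
    ∃ s ∈ decSet (ui i), s ≤ r := by
  obtain ⟨S, T, hS, hT, h, rfl⟩ := hr
  refine ⟨_, ⟨auxCoord S i, auxCoord T i, (aux_cp_lp _).1 hS i, (aux_cp_lp _).1 hT i,
    (aux_decMat_lp u S T ui (auxCoord S) (auxCoord T) hui (fun _ _ => rfl) (fun _ _ => rfl)).1 h i,
    rfl⟩, ?_⟩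
  exact max_le_max (LinearMap.mkContinuous_norm_le _ (norm_nonneg _) _)
    (LinearMap.mkContinuous_norm_le _ (norm_nonneg _) _)

theorem aux_glue_dec {A I : Type*} [NonUnitalCStarAlgebra A] {B : I → Type*}
    [∀ i, NonUnitalCStarAlgebra (B i)]
    (u : A →L[ℂ] lp B ∞) (ui : ∀ i, A →L[ℂ] B i)
    (hui : ∀ i x, ui i x = (u x : ∀ i, B i) i) (hd : ∀ i, IsDecomposable (ui i))
    (C : ℝ) (hC : 0 ≤ C) (h : ∀ i, decNorm (ui i) < C) :
    ∃ r ∈ decSet u, r ≤ C := by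
  have h1 : ∀ i, ∃ S T : A →L[ℂ] B i, IsCPMap ⇑S ∧ IsCPMap ⇑T ∧
      IsCPMap (fun x =>
        (!![S x, ui i x; star (ui i (star x)), T x] : Matrix (Fin 2) (Fin 2) (B i))) ∧
      ‖S‖ ≤ C ∧ ‖T‖ ≤ C := by
    intro i
    obtain ⟨_, ⟨S, T, hS, hT, h, rfl⟩, hlt⟩ :=
      exists_lt_of_csInf_lt (aux_dec_nonempty _ (hd i)) (h i)
    exact ⟨S, T, hS, hT, h, (le_max_left _ _).trans hlt.le, (le_max_right _ _).trans hlt.le⟩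
  choose S T hS hT hM hSC hTC using h1
  refine ⟨_, ⟨auxGlue S C hC hSC, auxGlue T C hC hTC, (aux_cp_lp _).2 hS, (aux_cp_lp _).2 hT,
    (aux_decMat_lp u _ _ ui S T hui (fun _ _ => rfl) (fun _ _ => rfl)).2 hM, rfl⟩, ?_⟩
  exact max_le (LinearMap.mkContinuous_norm_le _ hC _) (LinearMap.mkContinuous_norm_le _ hC _)

end Aux

/-- Decomposable maps into an ℓ∞-direct sum `(⊕Σᵢ Bᵢ)_∞` of C*-algebras: `u` is decomposable
iff every coordinate `uᵢ = pᵢ ∘ u` is, with uniformly bounded decomposable norms, and then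
`‖u‖_dec = supᵢ ‖uᵢ‖_dec`. -/
theorem isDecomposable_into_linfty_directSum_iff
    {A : Type*} [NonUnitalCStarAlgebra A] {I : Type*} {B : I → Type*}
    [∀ i, NonUnitalCStarAlgebra (B i)]
    (u : A →L[ℂ] lp B ∞) (ui : ∀ i, A →L[ℂ] B i)
    (hui : ∀ i x, ui i x = (u x : ∀ i, B i) i) :
    (IsDecomposable u ↔
      (∀ i, IsDecomposable (ui i)) ∧ BddAbove (Set.range fun i => decNorm (ui i))) ∧
    (IsDecomposable u → decNorm u = ⨆ i, decNorm (ui i)) := by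
  have hcoord : IsDecomposable u → (∀ i, IsDecomposable (ui i)) ∧
      ∀ i, decNorm (ui i) ≤ decNorm u := by
    intro h
    have hne := aux_dec_nonempty u h
    refine ⟨fun i => ?_, fun i => ?_⟩
    · obtain ⟨r, hr⟩ := hne
      obtain ⟨s, hs, -⟩ := aux_coord_dec u ui hui hr i
      exact aux_dec_of_nonempty _ ⟨s, hs⟩
    · refine le_csInf hne fun r hr => ?_
      obtain ⟨s, hs, hsr⟩ := aux_coord_dec u ui hui hr i
      exact (aux_decNorm_le _ hs).trans hsr
  have hbdd : IsDecomposable u → BddAbove (Set.range fun i => decNorm (ui i)) := by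
    intro h
    refine ⟨decNorm u, ?_⟩
    rintro _ ⟨i, rfl⟩
    exact (hcoord h).2 i
  refine ⟨⟨fun h => ⟨(hcoord h).1, hbdd h⟩, ?_⟩, fun h => le_antisymm ?_ ?_⟩
  · rintro ⟨hd, K, hK⟩
    obtain ⟨r, hr, -⟩ := aux_glue_dec u ui hui hd (|K| + 1) (by positivity) fun i =>
      lt_of_le_of_lt ((hK ⟨i, rfl⟩).trans (le_abs_self K)) (lt_add_one _)
    exact aux_dec_of_nonempty _ ⟨r, hr⟩
  · refine le_of_forall_pos_le_add fun ε hε => ?_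
    have h0 : 0 ≤ ⨆ i, decNorm (ui i) := Real.iSup_nonneg fun i => aux_decNorm_nonneg _
    obtain ⟨r, hr, hle⟩ := aux_glue_dec u ui hui (hcoord h).1 ((⨆ i, decNorm (ui i)) + ε)
      (by positivity) fun i => lt_of_le_of_lt (le_ciSup (hbdd h) i) (lt_add_of_pos_right _ hε)
    exact (aux_decNorm_le _ hr).trans hle
  · exact Real.iSup_le (hcoord h).2 (aux_decNorm_nonneg u)
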